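/- For a positive integer n, there exists a tree T on n vertices admitting an eigenvector x for eigenvalue 1 with x(v) ∈ {1, −1} for every vertex v, if and only if n ≡ 2 (mod 4). -/

import Mathlib

open SimpleGraph

open scoped Classical

/-- The real adjacency matrix of a simple graph. -/
noncomputable def adjMat {V : Type*} (G : SimpleGraph V) : Matrix V V ℝ :=
  fun u v => if G.Adj u v then 1 else 0

/-- The eigenspace `{x : A x = μ x}` of the adjacency matrix of `G`. -/
noncomputable def eigSpace {V : Type*} [Fintype V] (G : SimpleGraph V) (μ : ℝ) :
    Submodule ℝ (V → ℝ) :=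
  LinearMap.ker ((adjMat G).mulVecLin - μ • LinearMap.id)

/-- `x` is an eigenvector of `G` for eigenvalue `μ`. -/
def IsEigenvector {V : Type*} [Fintype V] (G : SimpleGraph V) (μ : ℝ) (x : V → ℝ) : Prop :=
  x ≠ 0 ∧ (adjMat G).mulVec x = μ • x

/-- `N_μ(G)`: vertices on which every eigenvector of `G` for `μ` vanishes. -/
def nSet {V : Type*} [Fintype V] (G : SimpleGraph V) (μ : ℝ) : Set V :=
  {v | ∀ x : V → ℝ, IsEigenvector G μ x → x v = 0}

/-- `N^C_μ(G)`: vertices of `N_μ(G)` with a neighbor outside `N_μ(G)`. -/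
def ncSet {V : Type*} [Fintype V] (G : SimpleGraph V) (μ : ℝ) : Set V :=
  {v | v ∈ nSet G μ ∧ ∃ w, G.Adj v w ∧ w ∉ nSet G μ}

/-- `C` is the vertex set of a connected component of the induced subgraph `G[S]`. -/
def IsCompOf {V : Type*} (G : SimpleGraph V) (S C : Set V) : Prop :=
  ∃ c : (G.induce S).ConnectedComponent, C = Subtype.val '' c.supp

theorem adjMat_mulVec_apply {V : Type*} [Fintype V] (G : SimpleGraph V) (x : V → ℝ) (v : V) :
    (adjMat G).mulVec x v = ∑ w, if G.Adj v w then x w else 0 := by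
  simp [Matrix.mulVec, dotProduct, adjMat]

/-- Eigenvectors pull back along a relabelling of the vertices. -/
theorem IsEigenvector.comap {V W : Type*} [Fintype V] [Fintype W] {G : SimpleGraph W} {μ : ℝ}
    {x : W → ℝ} (h : IsEigenvector G μ x) (e : V ≃ W) :
    IsEigenvector (G.comap e) μ (x ∘ e) := by
  refine ⟨fun h0 => h.1 (funext fun w => by simpa using congrFun h0 (e.symm w)),
    funext fun v => ?_⟩
  have hv := congrFun h.2 (e v)
  rw [adjMat_mulVec_apply] at hv ⊢
  rw [← e.sum_comp] at hv
  simpa using hv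

/-- The number of vertices of a tree with a `±1` eigenvector for the eigenvalue `1`. -/
theorem card_mod_four_of_isEigenvector_one {V : Type*} [Fintype V] {G : SimpleGraph V}
    (hG : G.IsTree) {x : V → ℝ} (hx : IsEigenvector G 1 x) (hpm : ∀ v, x v = 1 ∨ x v = -1) :
    Fintype.card V % 4 = 2 := by
  let H : SimpleGraph V :=
    { Adj := fun u v => G.Adj u v ∧ x u = x v
      symm := ⟨fun u v h => ⟨h.1.symm, h.2.symm⟩⟩
      loopless := ⟨fun u h => G.loopless.irrefl u h.1⟩ }
  have hdeg (v : V) : 2 * (H.degree v : ℝ) = G.degree v + 1 := by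
    have hv := congrFun hx.2 v
    rw [adjMat_mulVec_apply] at hv
    have hsq (w : V) : x w * x w = 1 := by rcases hpm w with h | h <;> simp [h]
    have hsum : ∑ w, (if G.Adj v w then x v * x w else 0) = 1 := by
      have := congrArg (x v * ·) hv
      simpa [Finset.mul_sum, hsq] using this
    rw [← hsum, ← card_neighborFinset_eq_degree, ← card_neighborFinset_eq_degree,
      neighborFinset_eq_filter, neighborFinset_eq_filter, Finset.natCast_card_filter,
      Finset.natCast_card_filter, Finset.mul_sum, ← Finset.sum_add_distrib]
    refine Finset.sum_congr rfl fun w _ => ?_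
    by_cases hvw : G.Adj v w
    · rcases hpm v with h | h <;> rcases hpm w with h' | h' <;> norm_num [H, hvw, h, h']
    · simp [H, hvw]
  have hsum := Finset.sum_congr (rfl : (Finset.univ : Finset V) = _) fun v _ => hdeg v
  rw [← Finset.mul_sum, Finset.sum_add_distrib] at hsum
  have hG2 := G.sum_degrees_eq_twice_card_edges
  have hH2 := H.sum_degrees_eq_twice_card_edges
  have hcard := hG.card_edgeFinset
  simp only [Finset.sum_const, Finset.card_univ, nsmul_eq_mul, mul_one] at hsum
  norm_cast at hsum
  omega

/-- The vertices of a tree with `4 * k + 2` vertices: a rooted edge and `k` blocks of size `4`. -/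
abbrev BlockVertex (k : ℕ) : Type := Fin 2 ⊕ (Fin k × Fin 4)

/-- The parent function of the block tree; the root `Sum.inl 0` is its own parent. -/
def blockParent {k : ℕ} : BlockVertex k → BlockVertex k
  | .inl _ => .inl 0
  | .inr (i, j) => if j = 2 ∨ j = 3 then .inr (i, 1) else .inl 0

/-- The block tree: each block attaches to the root a leaf and a vertex with two further leaves. -/
def blockTree (k : ℕ) : SimpleGraph (BlockVertex k) :=
  SimpleGraph.fromRel fun u v => blockParent u = v

/-- The `±1` eigenvector of the block tree. -/
def blockVector {k : ℕ} : BlockVertex k → ℝ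
  | .inl _ => 1
  | .inr (_, j) => if j = 0 then 1 else -1

theorem blockTree_connected (k : ℕ) : (blockTree k).Connected := by
  have step (v : BlockVertex k) : (blockTree k).Reachable (blockParent v) v := by
    by_cases h : v = blockParent v
    · rw [← h]
    · exact Adj.reachable (by simp [blockTree, Ne.symm h])
  refine (connected_iff_exists_forall_reachable _).2 ⟨.inl 0, ?_⟩
  rintro (a | ⟨i, j⟩)
  · exact step (.inl a)
  · by_cases hj : j = 2 ∨ j = 3
    · have h1 := step (.inr (i, 1))
      have h2 := step (.inr (i, j))
      simp [blockParent] at h1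
      simp only [blockParent, hj, if_true] at h2
      exact h1.trans h2
    · simpa [blockParent, hj] using step (.inr (i, j))

theorem blockTree_isTree (k : ℕ) : (blockTree k).IsTree := by
  have hc := blockTree_connected k
  refine isTree_iff_connected_and_card.2 ⟨hc, le_antisymm ?_ hc.card_vert_le_card_edgeSet_add_one⟩
  have hsub : (blockTree k).edgeFinset ⊆
      (Finset.univ.erase (.inl 0)).image fun v => s(v, blockParent v) := by
    intro e
    induction e with | _ u v
    rw [mem_edgeFinset, mem_edgeSet, blockTree, fromRel_adj]
    simp only [Finset.mem_image, Finset.mem_erase, Finset.mem_univ, and_true]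
    rintro ⟨hne, h | h⟩
    · refine ⟨u, ?_, by rw [h]⟩
      rintro rfl
      exact hne h
    · refine ⟨v, ?_, by rw [h, Sym2.eq_swap]⟩
      rintro rfl
      exact hne h.symm
  have hle := (Finset.card_le_card hsub).trans Finset.card_image_le
  rw [Finset.card_erase_of_mem (Finset.mem_univ _), Finset.card_univ] at hle
  have hpos : 0 < Fintype.card (BlockVertex k) := Fintype.card_pos_iff.2 ⟨.inl 0⟩
  rw [Nat.card_eq_fintype_card, Nat.card_eq_fintype_card, ← edgeFinset_card]
  omega

theorem blockTree_isEigenvector (k : ℕ) : IsEigenvector (blockTree k) 1 blockVector := by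
  refine ⟨fun h => by simpa [blockVector] using congrFun h (.inl 0), funext fun v => ?_⟩
  rw [adjMat_mulVec_apply]
  rcases v with a | ⟨i, j⟩
  · fin_cases a <;>
      simp [Fintype.sum_sum_type, Fintype.sum_prod_type, Fin.sum_univ_two, Fin.sum_univ_four,
        blockTree, blockParent, blockVector, -Finset.sum_boole]
  · fin_cases j <;>
      simp [Fintype.sum_sum_type, Fintype.sum_prod_type, Fin.sum_univ_four, blockTree,
        blockParent, blockVector, Finset.sum_add_distrib]

theorem stmt_17 (n : ℕ) (hn : 0 < n) :
    (∃ G : SimpleGraph (Fin n), G.IsTree ∧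
        ∃ x : Fin n → ℝ, IsEigenvector G 1 x ∧ ∀ v, x v = 1 ∨ x v = -1) ↔
      n % 4 = 2 := by
  constructor
  · rintro ⟨G, hG, x, hx, hpm⟩
    simpa using card_mod_four_of_isEigenvector_one hG hx hpm
  · intro h
    have hcard : Fintype.card (Fin n) = Fintype.card (BlockVertex (n / 4)) := by
      simp
      omega
    let e := Fintype.equivOfCardEq hcard
    refine ⟨(blockTree (n / 4)).comap e, (Iso.comap e _).isTree_iff.2 (blockTree_isTree _),
      blockVector ∘ e, (blockTree_isEigenvector _).comap e, fun v => ?_⟩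
    rw [Function.comp_apply]
    rcases e v with a | ⟨i, j⟩
    · exact Or.inl rfl
    · exact ite_eq_or_eq _ _ _
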